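/- arXiv:1708.06422 — 4 statements merged into one kernel-verified Lean document; each statement's English description precedes it below -/
import Mathlib

section
/- Let ψ : (0,∞) → ℝ be a smooth, real-valued, rapidly decaying fiducial vector with unit L² norm. Then for every q > 0 and p ∈ ℝ the iterated integral (1/(2π c₋₁(ψ))) ∫₀^∞ ( ∫_ℝ p′ |⟨U(q,p)ψ, U(q′,p′)ψ⟩|² dp′ ) dq′ converges and equals p. (The lower symbol of the momentum is p̌ = p.) -/
open MeasureTheory Set Filter

/-- The affine group representation `(U(q,p)ψ)(x) = e^{ipx} q^{-1/2} ψ(x/q)`. -/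
noncomputable def Uop (q p : ℝ) (ψ : ℝ → ℂ) : ℝ → ℂ :=
  fun x => Complex.exp (Complex.I * (p : ℂ) * (x : ℂ)) * ((Real.sqrt q : ℝ) : ℂ)⁻¹ * ψ (x / q)

/-- Inner product `⟨f,g⟩ = ∫₀^∞ conj(f x) g x dx`, conjugate-linear in the first argument. -/
noncomputable def hinner (f g : ℝ → ℂ) : ℂ :=
  ∫ x in Set.Ioi (0:ℝ), (starRingEnd ℂ) (f x) * g x

/-- The constant `c_γ(ψ) = ∫₀^∞ ψ(x)² x^{-(γ+2)} dx` for a real fiducial vector. -/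
noncomputable def cgamR (γ : ℝ) (ψ : ℝ → ℝ) : ℝ :=
  ∫ x in Set.Ioi (0:ℝ), (ψ x) ^ 2 * x ^ (-(γ + 2))

/-- A smooth real fiducial vector all of whose derivatives decay faster than any power
of `x` as `x → 0⁺` and as `x → ∞`. -/
def RapidlyDecaying (ψ : ℝ → ℝ) : Prop :=
  ContDiff ℝ (⊤ : ℕ∞) ψ ∧ ∀ N k : ℕ,
    Filter.Tendsto (fun x => iteratedDeriv k ψ x / x ^ N)
      (nhdsWithin 0 (Set.Ioi (0:ℝ))) (nhds 0) ∧
    Filter.Tendsto (fun x => x ^ N * iteratedDeriv k ψ x) Filter.atTop (nhds 0)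

open scoped SchwartzMap FourierTransform

/-- The cut-off at the origin of the `k`-th derivative is differentiable, with derivative the
cut-off of the next one. -/
lemma RapidlyDecaying.hasDerivAt_indicator {ψ : ℝ → ℝ} (hψ : RapidlyDecaying ψ) (k : ℕ) (x : ℝ) :
    HasDerivAt ((Ioi (0:ℝ)).indicator (iteratedDeriv k ψ))
      ((Ioi (0:ℝ)).indicator (iteratedDeriv (k + 1) ψ) x) x := by
  rcases lt_trichotomy x 0 with hx | rfl | hx
  · rw [indicator_of_notMem (by simpa using hx.le)]
    refine (hasDerivAt_const x (0:ℝ)).congr_of_eventuallyEq ?_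
    filter_upwards [Iio_mem_nhds hx] with y hy
    exact indicator_of_notMem (by simpa using (mem_Iio.mp hy).le) _
  · rw [indicator_of_notMem (by simp), hasDerivAt_iff_tendsto_slope,
      ← Iio_union_Ioi, nhdsWithin_union]
    refine Tendsto.sup ?_ ?_
    · refine tendsto_const_nhds.congr' ?_
      filter_upwards [self_mem_nhdsWithin] with y hy
      simp [slope_def_field, (mem_Iio.mp hy).le]
    · refine (hψ.2 1 k).1.congr' ?_
      filter_upwards [self_mem_nhdsWithin] with y hy
      simp [slope_def_field, indicator_of_mem hy]
  · rw [indicator_of_mem (mem_Ioi.mpr hx)]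
    have hd : HasDerivAt (iteratedDeriv k ψ) (iteratedDeriv (k + 1) ψ x) x := by
      rw [iteratedDeriv_succ]
      exact (hψ.1.differentiable_iteratedDeriv k
        (by exact_mod_cast WithTop.coe_lt_top _) x).hasDerivAt
    refine hd.congr_of_eventuallyEq ?_
    filter_upwards [Ioi_mem_nhds hx] with y hy
    exact indicator_of_mem hy _

lemma RapidlyDecaying.iteratedDeriv_indicator {ψ : ℝ → ℝ} (hψ : RapidlyDecaying ψ) (k : ℕ) :
    iteratedDeriv k ((Ioi (0:ℝ)).indicator ψ) = (Ioi (0:ℝ)).indicator (iteratedDeriv k ψ) := by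
  induction k with
  | zero => simp
  | succ k ih =>
    rw [iteratedDeriv_succ, ih]
    ext x
    exact (hψ.hasDerivAt_indicator k x).deriv

/-- A continuous function on the line with limits at both ends is bounded. -/
lemma Continuous.exists_norm_le_of_tendsto {g : ℝ → ℝ} (hg : Continuous g) {a b : ℝ}
    (hbot : Tendsto g atBot (nhds a)) (htop : Tendsto g atTop (nhds b)) :
    ∃ C, ∀ x, ‖g x‖ ≤ C := by
  obtain ⟨A, hA⟩ := eventually_atBot.mp (hbot.norm.eventually_le_const (lt_add_one ‖a‖))
  obtain ⟨B, hB⟩ := eventually_atTop.mp (htop.norm.eventually_le_const (lt_add_one ‖b‖))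
  obtain ⟨D, hD⟩ := (isCompact_Icc (a := A) (b := B)).exists_bound_of_continuousOn hg.continuousOn
  refine ⟨max D (max (‖a‖ + 1) (‖b‖ + 1)), fun x => ?_⟩
  rcases le_total x A with h | h
  · exact (hA x h).trans (by simp)
  rcases le_total x B with h' | h'
  · exact (hD x ⟨h, h'⟩).trans (by simp)
  · exact (hB x h').trans (by simp)

/-- The extension by zero of a rapidly decaying fiducial vector is a Schwartz function. -/
lemma RapidlyDecaying.exists_schwartzMap {ψ : ℝ → ℝ} (hψ : RapidlyDecaying ψ) :
    ∃ φ : 𝓢(ℝ, ℝ), ∀ x, φ x = (Ioi (0:ℝ)).indicator ψ x := by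
  refine ⟨⟨(Ioi (0:ℝ)).indicator ψ, ?_, fun n k => ?_⟩, fun x => rfl⟩
  · refine contDiff_of_differentiable_iteratedDeriv fun k _ x => ?_
    rw [hψ.iteratedDeriv_indicator]
    exact (hψ.hasDerivAt_indicator k x).differentiableAt
  · have hc : Continuous ((Ioi (0:ℝ)).indicator (iteratedDeriv k ψ)) :=
      continuous_iff_continuousAt.mpr fun x => (hψ.hasDerivAt_indicator k x).continuousAt
    obtain ⟨C, hC⟩ := ((continuous_id.pow n).mul hc).exists_norm_le_of_tendsto (a := 0) (b := 0)
      (tendsto_const_nhds.congr' (by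
        filter_upwards [eventually_le_atBot (0:ℝ)] with x hx
        simp [hx]))
      ((hψ.2 n k).2.congr' (by
        filter_upwards [eventually_gt_atTop (0:ℝ)] with x hx
        simp [hx]))
    refine ⟨C, fun x => ?_⟩
    rw [norm_iteratedFDeriv_eq_norm_iteratedDeriv, hψ.iteratedDeriv_indicator]
    simpa using hC x

lemma SchwartzMap.exists_mul_comp_mul (φ : 𝓢(ℝ, ℝ)) (a : ℝ) {b c : ℝ} (hb : b ≠ 0) (hc : c ≠ 0) :
    ∃ f : 𝓢(ℝ, ℂ), ∀ x, f x = ((a * (φ (b * x) * φ (c * x)) : ℝ) : ℂ) := by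
  let dil (r : ℝ) (hr : r ≠ 0) : 𝓢(ℝ, ℝ) :=
    compCLMOfContinuousLinearEquiv ℝ (ContinuousLinearEquiv.unitsEquivAut ℝ (Units.mk0 r hr)) φ
  refine ⟨a • postcompCLM Complex.ofRealCLM
    (pairing (ContinuousLinearMap.mul ℝ ℝ) (dil b hb) (dil c hc)), fun x => ?_⟩
  simp [dil, mul_comm]

/-- First moment of the squared modulus of the Fourier transform of a real function, centred
at `p`. -/
lemma SchwartzMap.integral_mul_normSq_fourier_of_real (f : 𝓢(ℝ, ℂ))
    (hf : ∀ x, (starRingEnd ℂ) (f x) = f x) (p : ℝ) :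
    Integrable (fun s : ℝ =>
      s * ‖∫ x : ℝ, Complex.exp (Complex.I * ((s - p : ℝ) : ℂ) * x) * f x‖ ^ 2) ∧
    ∫ s : ℝ, s * ‖∫ x : ℝ, Complex.exp (Complex.I * ((s - p : ℝ) : ℂ) * x) * f x‖ ^ 2
      = 2 * Real.pi * p * ∫ x, ‖f x‖ ^ 2 := by
  have hpi := Real.pi_pos
  set h : ℝ → ℝ := fun ξ => ‖𝓕 f ξ‖ ^ 2 with hh
  set k : ℝ → ℝ := fun ξ => p * h ξ - 2 * Real.pi * (ξ * h ξ) with hk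
  have hI0 : Integrable h := ((𝓕 f).memLp 2 volume).integrable_norm_pow (by norm_num)
  have hI1 : Integrable fun ξ => ξ * h ξ := by
    obtain ⟨C, hC⟩ := (𝓕 f).decay 0 0
    have hi := (((𝓕 f).integrable_pow_mul volume 1).mul_const C)
    refine hi.mono' (by fun_prop) (.of_forall fun ξ => ?_)
    have := hC.2 ξ
    simp only [pow_zero, one_mul, norm_iteratedFDeriv_zero] at this
    simp only [hh, norm_mul, norm_norm, pow_one, sq, ← mul_assoc]
    gcongr
  have hIk : Integrable k := (hI0.const_mul p).sub (hI1.const_mul _)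
  have hodd : ∫ ξ, ξ * h ξ = 0 := by
    have heven : ∀ ξ, h (-ξ) = h ξ := fun ξ => by
      have : 𝓕 f (-ξ) = (starRingEnd ℂ) (𝓕 f ξ) := by
        rw [fourier_coe, Real.fourier_real_eq_integral_exp_smul,
          Real.fourier_real_eq_integral_exp_smul, ← integral_conj]
        congr 1 with x
        simp [hf, ← Complex.exp_conj, Complex.conj_ofNat]
      simp [hh, this]
    have := integral_neg_eq_self (fun ξ => ξ * h ξ) volume
    simp only [heven, neg_mul, integral_neg] at this
    linarith
  have hint : ∫ ξ, k ξ = p * ∫ x, ‖f x‖ ^ 2 := by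
    rw [hk, integral_sub (hI0.const_mul p) (hI1.const_mul _), integral_const_mul,
      integral_const_mul, hodd, hh, integral_norm_sq_fourier]
    ring
  have key : (fun s : ℝ =>
      s * ‖∫ x : ℝ, Complex.exp (Complex.I * ((s - p : ℝ) : ℂ) * x) * f x‖ ^ 2)
      = fun s => k ((p - s) / (2 * Real.pi)) := by
    ext s
    have h1 : ∫ x : ℝ, Complex.exp (Complex.I * ((s - p : ℝ) : ℂ) * x) * f x
        = 𝓕 f ((p - s) / (2 * Real.pi)) := by
      rw [fourier_coe, Real.fourier_real_eq_integral_exp_smul]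
      congr 1 with x
      rw [smul_eq_mul]
      congr 2
      have : (Real.pi : ℂ) ≠ 0 := by exact_mod_cast hpi.ne'
      push_cast
      field_simp
      ring
    rw [h1]
    simp only [hk, hh]
    field_simp
    ring
  rw [key]
  refine ⟨(hIk.comp_div (by positivity)).comp_sub_left p, ?_⟩
  rw [integral_sub_left_eq_self (fun y => k (y / (2 * Real.pi))) volume p,
    Measure.integral_comp_div, hint, abs_of_pos (by positivity), smul_eq_mul]
  ring

/-- A Schwartz function vanishing at the origin is square-integrable against `du / u`. -/
lemma SchwartzMap.integrableOn_sq_mul_inv (φ : 𝓢(ℝ, ℝ)) (h0 : φ 0 = 0) :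
    IntegrableOn (fun u : ℝ => φ u ^ 2 * u⁻¹) (Ioi 0) := by
  obtain ⟨C, -, hC⟩ := φ.decay 0 1
  have hlip : ∀ u, ‖φ u‖ ≤ C * ‖u‖ := fun u => by
    have := convex_univ.norm_image_sub_le_of_norm_deriv_le (f := φ) (C := C) (x := 0) (y := u)
      (fun x _ => φ.differentiableAt)
      (fun x _ => by simpa [norm_iteratedFDeriv_eq_norm_iteratedDeriv] using hC x) trivial trivial
    simpa [h0] using this
  refine ((φ.integrable (μ := volume)).norm.const_mul C).integrableOn.mono'
    (Measurable.aestronglyMeasurable (by fun_prop)) ?_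
  filter_upwards [ae_restrict_mem measurableSet_Ioi] with u hu
  have hu : 0 < u := hu
  have h := hlip u
  rw [Real.norm_of_nonneg hu.le] at h
  rw [norm_mul, norm_inv, norm_pow, Real.norm_of_nonneg hu.le, ← div_eq_mul_inv, div_le_iff₀ hu]
  nlinarith [norm_nonneg (φ u)]

/-- The resolution-of-identity integral: the scale average of the dilated products. -/
lemma SchwartzMap.integral_dilation_mul_sq (φ : 𝓢(ℝ, ℝ)) (h0 : φ 0 = 0) {q : ℝ} (hq : 0 < q) :
    IntegrableOn (fun r : ℝ => ∫ u in Ioi (0:ℝ), q⁻¹ * φ (r * (u / q)) ^ 2 * φ u ^ 2) (Ioi 0) ∧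
    ∫ r in Ioi (0:ℝ), ∫ u in Ioi (0:ℝ), q⁻¹ * φ (r * (u / q)) ^ 2 * φ u ^ 2
      = (∫ u in Ioi (0:ℝ), φ u ^ 2) * ∫ u in Ioi (0:ℝ), φ u ^ 2 * u⁻¹ := by
  have hsq : Integrable fun u => φ u ^ 2 := by
    simpa using (φ.memLp 2 volume).integrable_norm_pow (by norm_num)
  have hslice : ∀ u ∈ Ioi (0:ℝ), ∫ r in Ioi (0:ℝ), q⁻¹ * φ (r * (u / q)) ^ 2 * φ u ^ 2
      = (∫ u in Ioi (0:ℝ), φ u ^ 2) * (φ u ^ 2 * u⁻¹) := fun u hu => by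
    have hu : 0 < u := hu
    rw [integral_mul_const, integral_const_mul,
      integral_comp_mul_right_Ioi (fun y => φ y ^ 2) 0 (div_pos hu hq), zero_mul, smul_eq_mul]
    field_simp
  have hprod : Integrable (Function.uncurry fun r u : ℝ => q⁻¹ * φ (r * (u / q)) ^ 2 * φ u ^ 2)
      ((volume.restrict (Ioi 0)).prod (volume.restrict (Ioi 0))) := by
    refine (integrable_prod_iff' (Continuous.aestronglyMeasurable (by
      simp only [Function.uncurry_def]; fun_prop))).mpr ⟨?_, ?_⟩
    · filter_upwards [ae_restrict_mem measurableSet_Ioi] with u hu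
      have hu : 0 < u := hu
      exact (((hsq.comp_mul_right' (div_pos hu hq).ne').const_mul q⁻¹).mul_const
        (φ u ^ 2)).integrableOn (s := Ioi 0)
    · refine ((φ.integrableOn_sq_mul_inv h0).const_mul (∫ u in Ioi (0:ℝ), φ u ^ 2)).congr ?_
      filter_upwards [ae_restrict_mem measurableSet_Ioi] with u hu
      rw [← hslice u hu]
      congr 1 with r
      exact (Real.norm_of_nonneg (by positivity)).symm
  refine ⟨hprod.integral_prod_left, ?_⟩
  rw [integral_integral_swap hprod, setIntegral_congr_fun measurableSet_Ioi hslice,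
    integral_const_mul]

/-- The overlap of two affine coherent states is a Fourier-type integral over the line of a
real Schwartz function. -/
lemma exists_schwartzMap_hinner_Uop {ψ : ℝ → ℝ} (φ : 𝓢(ℝ, ℝ))
    (hφ : ∀ x, φ x = (Ioi (0:ℝ)).indicator ψ x) {q q' : ℝ} (hq : 0 < q) (hq' : 0 < q') :
    ∃ f : 𝓢(ℝ, ℂ), (∀ x, (starRingEnd ℂ) (f x) = f x) ∧
      (∀ p p' : ℝ, hinner (Uop q p fun x => (ψ x : ℂ)) (Uop q' p' fun x => (ψ x : ℂ))
        = ∫ x : ℝ, Complex.exp (Complex.I * ((p' - p : ℝ) : ℂ) * x) * f x) ∧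
      ∫ x, ‖f x‖ ^ 2 = ∫ u in Ioi (0:ℝ), q⁻¹ * φ (q' * (u / q)) ^ 2 * φ u ^ 2 := by
  obtain ⟨f, hf⟩ := φ.exists_mul_comp_mul ((√q)⁻¹ * (√q')⁻¹) (inv_pos.mpr hq).ne'
    (inv_pos.mpr hq').ne'
  have hzero : ∀ x ∉ Ioi (0:ℝ), f x = 0 := fun x hx => by
    have : φ (q⁻¹ * x) = 0 := by
      rw [hφ, indicator_of_notMem]
      simpa using mul_nonpos_of_nonneg_of_nonpos (inv_pos.mpr hq).le (by simpa using hx)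
    simp [hf, this]
  refine ⟨f, fun x => by rw [hf, Complex.conj_ofReal], fun p p' => ?_, ?_⟩
  · have hres := setIntegral_eq_integral_of_forall_compl_eq_zero (μ := volume) (s := Ioi (0:ℝ))
      (f := fun x : ℝ => Complex.exp (Complex.I * ((p' - p : ℝ) : ℂ) * x) * f x)
      fun x hx => by rw [hzero x hx, mul_zero]
    rw [hinner, ← hres]
    refine setIntegral_congr_fun measurableSet_Ioi fun x hx => ?_
    have hx : 0 < x := hx
    have e : Complex.exp (Complex.I * ((p' - p : ℝ) : ℂ) * x)
        = Complex.exp (-(Complex.I * p * x)) * Complex.exp (Complex.I * p' * x) := by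
      rw [← Complex.exp_add]
      push_cast
      ring_nf
    simp only [hf, hφ, Uop, e]
    rw [indicator_of_mem (mem_Ioi.mpr (by positivity)),
      indicator_of_mem (mem_Ioi.mpr (by positivity))]
    simp only [map_mul, map_inv₀, ← Complex.exp_conj, Complex.conj_ofReal, Complex.conj_I,
      div_eq_inv_mul, Complex.ofReal_mul, Complex.ofReal_inv, neg_mul]
    ring
  · rw [← setIntegral_eq_integral_of_forall_compl_eq_zero (s := Ioi (0:ℝ))
      fun x hx => by simp [hzero x hx]]
    have := integral_comp_mul_left_Ioi' (fun x => ‖f x‖ ^ 2) 0 hq'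
    rw [mul_zero] at this
    rw [← this, smul_eq_mul, ← integral_const_mul]
    refine setIntegral_congr_fun measurableSet_Ioi fun u _ => ?_
    have e : q⁻¹ * (q' * u) = q' * (u / q) := by ring
    simp only [hf, Complex.norm_real, Real.norm_eq_abs, sq_abs, mul_pow, inv_pow,
      Real.sq_sqrt hq.le, Real.sq_sqrt hq'.le, inv_mul_cancel_left₀ hq'.ne', e]
    field_simp

/-- The lower symbol of the momentum is `p̌ = p`:
`(1/(2π c₋₁)) ∫₀^∞ ∫_ℝ p′ |⟨U(q,p)ψ, U(q′,p′)ψ⟩|² dp′ dq′ = p`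
for a smooth, real, rapidly decaying, unit-norm fiducial vector. -/
theorem lower_symbol_of_p (ψ : ℝ → ℝ)
    (hψ : RapidlyDecaying ψ)
    (hnorm : ∫ x in Set.Ioi (0:ℝ), (ψ x) ^ 2 = 1)
    (q p : ℝ) (hq : 0 < q) :
    (∀ q' ∈ Set.Ioi (0:ℝ), Integrable (fun p' : ℝ =>
        p' * ‖hinner (Uop q p (fun x => (ψ x : ℂ)))
          (Uop q' p' (fun x => (ψ x : ℂ)))‖ ^ 2)) ∧
    IntegrableOn (fun q' : ℝ => ∫ p' : ℝ,
        p' * ‖hinner (Uop q p (fun x => (ψ x : ℂ)))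
          (Uop q' p' (fun x => (ψ x : ℂ)))‖ ^ 2) (Set.Ioi (0:ℝ)) ∧
    (1 / (2 * Real.pi * cgamR (-1) ψ)) * (∫ q' in Set.Ioi (0:ℝ), ∫ p' : ℝ,
        p' * ‖hinner (Uop q p (fun x => (ψ x : ℂ)))
          (Uop q' p' (fun x => (ψ x : ℂ)))‖ ^ 2) = p := by
  obtain ⟨φ, hφ⟩ := hψ.exists_schwartzMap
  have h0 : φ 0 = 0 := by simp [hφ]
  have hφψ : ∀ u ∈ Ioi (0:ℝ), φ u = ψ u := fun u hu => by rw [hφ, indicator_of_mem hu]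
  have hnormφ : ∫ u in Ioi (0:ℝ), φ u ^ 2 = 1 := by
    rw [← hnorm]
    exact setIntegral_congr_fun measurableSet_Ioi fun u hu => by simp only [hφψ u hu]
  have hc : cgamR (-1) ψ = ∫ u in Ioi (0:ℝ), φ u ^ 2 * u⁻¹ := by
    refine setIntegral_congr_fun measurableSet_Ioi fun u hu => ?_
    simp only [hφψ u hu]
    norm_num [Real.rpow_neg_one]
  have hcne : cgamR (-1) ψ ≠ 0 := fun h => by
    rw [hc, setIntegral_eq_zero_iff_of_nonneg_ae ?_ (φ.integrableOn_sq_mul_inv h0)] at h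
    · refine one_ne_zero (hnormφ.symm.trans (integral_eq_zero_of_ae ?_))
      filter_upwards [h, ae_restrict_mem measurableSet_Ioi] with u hu hu0
      exact (mul_eq_zero.mp hu).resolve_right (inv_ne_zero (ne_of_gt hu0))
    · filter_upwards [ae_restrict_mem measurableSet_Ioi] with u hu
      exact mul_nonneg (sq_nonneg _) (inv_nonneg.mpr (le_of_lt hu))
  have hmoment : ∀ q' ∈ Ioi (0:ℝ), Integrable (fun p' : ℝ =>
        p' * ‖hinner (Uop q p (fun x => (ψ x : ℂ))) (Uop q' p' (fun x => (ψ x : ℂ)))‖ ^ 2) ∧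
      ∫ p' : ℝ, p' * ‖hinner (Uop q p (fun x => (ψ x : ℂ)))
          (Uop q' p' (fun x => (ψ x : ℂ)))‖ ^ 2
        = 2 * Real.pi * p * ∫ u in Ioi (0:ℝ), q⁻¹ * φ (q' * (u / q)) ^ 2 * φ u ^ 2 :=
      fun q' hq' => by
    obtain ⟨f, hreal, hinn, hsq⟩ := exists_schwartzMap_hinner_Uop φ hφ hq hq'
    simp only [hinn, ← hsq]
    exact f.integral_mul_normSq_fourier_of_real hreal p
  obtain ⟨hI, hval⟩ := φ.integral_dilation_mul_sq h0 hq
  refine ⟨fun q' hq' => (hmoment q' hq').1, ?_, ?_⟩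
  · exact IntegrableOn.congr_fun (hI.const_mul (2 * Real.pi * p))
      (fun q' hq' => (hmoment q' hq').2.symm) measurableSet_Ioi
  · rw [setIntegral_congr_fun measurableSet_Ioi fun q' hq' => (hmoment q' hq').2,
      integral_const_mul, hval, hnormφ, ← hc]
    have := Real.pi_ne_zero
    field_simp
end

section
/- Let ψ : (0,∞) → ℝ be a smooth, real-valued, rapidly decaying fiducial vector with unit L² norm and with c₀(ψ) and c₋₃(ψ) finite. Then for every q > 0 and p ∈ ℝ the iterated integral (1/(2π c₋₁(ψ))) ∫₀^∞ ( ∫_ℝ q′ p′ |⟨U(q,p)ψ, U(q′,p′)ψ⟩|² dp′ ) dq′ converges and equals (c₀(ψ) c₋₃(ψ)/c₋₁(ψ)) q p. (The lower symbol of qp is (c₀ c₋₃/c₋₁) qp.) -/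
open MeasureTheory Set Filter

open scoped SchwartzMap FourierTransform ContDiff

namespace RapidlyDecaying

variable {ψ : ℝ → ℝ}

lemma continuous_iteratedDeriv (hψ : RapidlyDecaying ψ) (k : ℕ) :
    Continuous (iteratedDeriv k ψ) :=
  hψ.1.continuous_iteratedDeriv k (by exact_mod_cast le_top)

lemma hasDerivAt_iteratedDeriv (hψ : RapidlyDecaying ψ) (k : ℕ) (x : ℝ) :
    HasDerivAt (iteratedDeriv k ψ) (iteratedDeriv (k + 1) ψ x) x := by
  rw [iteratedDeriv_succ]
  exact (hψ.1.differentiable_iteratedDeriv k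
    (by exact_mod_cast WithTop.coe_lt_top k) x).hasDerivAt

lemma iteratedDeriv_zero_eq_zero (hψ : RapidlyDecaying ψ) (k : ℕ) :
    iteratedDeriv k ψ 0 = 0 := by
  have h := (hψ.2 0 k).1
  simp only [pow_zero, div_one] at h
  exact tendsto_nhds_unique
    ((hψ.continuous_iteratedDeriv k).tendsto 0 |>.mono_left nhdsWithin_le_nhds) h

lemma hasDerivAt_indicator_s14 (hψ : RapidlyDecaying ψ) (k : ℕ) (x : ℝ) :
    HasDerivAt ((Ioi (0 : ℝ)).indicator (iteratedDeriv k ψ))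
      ((Ioi (0 : ℝ)).indicator (iteratedDeriv (k + 1) ψ) x) x := by
  rcases lt_trichotomy x 0 with hx | rfl | hx
  · rw [indicator_of_notMem (by simpa using hx.le)]
    refine (hasDerivAt_const x (0 : ℝ)).congr_of_eventuallyEq ?_
    filter_upwards [Iio_mem_nhds hx] with y hy
    exact indicator_of_notMem (by simpa using le_of_lt hy) _
  · rw [indicator_of_notMem (by simp), ← hasDerivWithinAt_univ, ← Iic_union_Ici (a := (0 : ℝ))]
    refine HasDerivWithinAt.union ?_ ?_
    · refine (hasDerivWithinAt_const 0 (Iic 0) (0 : ℝ)).congr (fun y hy => ?_) ?_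
      · exact indicator_of_notMem (by simpa using hy) _
      · simp
    · have h := (hψ.hasDerivAt_iteratedDeriv k 0).hasDerivWithinAt (s := Ici 0)
      rw [hψ.iteratedDeriv_zero_eq_zero] at h
      refine h.congr (fun y hy => ?_) (by simp [hψ.iteratedDeriv_zero_eq_zero])
      rcases (mem_Ici.mp hy).eq_or_lt with rfl | hy
      · simp [hψ.iteratedDeriv_zero_eq_zero]
      · exact indicator_of_mem (mem_Ioi.mpr hy) _
  · rw [indicator_of_mem (mem_Ioi.mpr hx)]
    refine (hψ.hasDerivAt_iteratedDeriv k x).congr_of_eventuallyEq ?_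
    filter_upwards [Ioi_mem_nhds hx] with y hy
    exact indicator_of_mem hy _

lemma iteratedDeriv_indicator_s14 (hψ : RapidlyDecaying ψ) (k : ℕ) :
    iteratedDeriv k ((Ioi (0 : ℝ)).indicator ψ) =
      (Ioi (0 : ℝ)).indicator (iteratedDeriv k ψ) := by
  induction k with
  | zero => simp
  | succ k ih =>
    rw [iteratedDeriv_succ, ih]
    exact funext fun x => (hψ.hasDerivAt_indicator_s14 k x).deriv

lemma contDiff_indicator (hψ : RapidlyDecaying ψ) :
    ContDiff ℝ ∞ ((Ioi (0 : ℝ)).indicator ψ) := by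
  refine contDiff_of_differentiable_iteratedDeriv fun k _ => ?_
  rw [hψ.iteratedDeriv_indicator_s14]
  exact fun x => (hψ.hasDerivAt_indicator_s14 k x).differentiableAt

lemma exists_bound_indicator (hψ : RapidlyDecaying ψ) (N k : ℕ) :
    ∃ C : ℝ, ∀ x : ℝ, ‖x‖ ^ N * ‖(Ioi (0 : ℝ)).indicator (iteratedDeriv k ψ) x‖ ≤ C := by
  obtain ⟨R, hR⟩ := (((hψ.2 N k).2.norm.eventually_le_const
    (u := 1) (by simp)).and (eventually_ge_atTop 0)).exists_forall_of_atTop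
  have hc : Continuous fun x : ℝ => ‖x ^ N * iteratedDeriv k ψ x‖ := by
    have := hψ.continuous_iteratedDeriv k
    fun_prop
  obtain ⟨C, hC⟩ := (isCompact_Icc (a := (0 : ℝ)) (b := R)).bddAbove_image hc.continuousOn
  refine ⟨max 1 (max C 0), fun x => ?_⟩
  by_cases hx : x ∈ Ioi (0 : ℝ)
  · rw [indicator_of_mem hx, ← norm_pow, ← norm_mul]
    rcases le_total R x with h | h
    · exact (hR x h).1.trans (le_max_left _ _)
    · exact (hC (mem_image_of_mem _ ⟨le_of_lt hx, h⟩)).trans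
        ((le_max_left _ _).trans (le_max_right _ _))
  · simp [indicator_of_notMem hx]

/-- The extension by zero of a rapidly decaying fiducial vector, as a Schwartz function. -/
noncomputable def toSchwartz (hψ : RapidlyDecaying ψ) : 𝓢(ℝ, ℝ) where
  toFun := (Ioi (0 : ℝ)).indicator ψ
  smooth' := hψ.contDiff_indicator
  decay' N k := by
    simp_rw [norm_iteratedFDeriv_eq_norm_iteratedDeriv, hψ.iteratedDeriv_indicator_s14]
    exact hψ.exists_bound_indicator N k

lemma toSchwartz_apply (hψ : RapidlyDecaying ψ) (x : ℝ) :
    hψ.toSchwartz x = (Ioi (0 : ℝ)).indicator ψ x := rfl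

lemma exists_schwartz_overlap (hψ : RapidlyDecaying ψ) {q q' : ℝ} (hq : 0 < q) (hq' : 0 < q') :
    ∃ g : 𝓢(ℝ, ℂ), ∀ x, g x =
      ((Ioi (0 : ℝ)).indicator (fun x => ψ (x / q) * ψ (x / q')) x : ℝ) := by
  let dil (a : ℝ) (ha : 0 < a) : 𝓢(ℝ, ℝ) := SchwartzMap.compCLMOfContinuousLinearEquiv ℝ
    (ContinuousLinearEquiv.smulLeft (Units.mk0 a⁻¹ (inv_pos.mpr ha).ne')) hψ.toSchwartz
  have hdil (a : ℝ) (ha : 0 < a) (x : ℝ) :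
      dil a ha x = (Ioi (0 : ℝ)).indicator (fun x => ψ (x / a)) x := by
    have h : dil a ha x = (Ioi (0 : ℝ)).indicator ψ (a⁻¹ * x) := rfl
    rw [h]
    by_cases hx : 0 < x
    · rw [indicator_of_mem (mem_Ioi.mpr (by positivity)), indicator_of_mem (mem_Ioi.mpr hx)]
      congr 1
      field_simp
    · have : a⁻¹ * x ≤ 0 := mul_nonpos_of_nonneg_of_nonpos (by positivity) (not_lt.mp hx)
      rw [indicator_of_notMem (by simpa using this), indicator_of_notMem (by simpa using hx)]
  let B : ℝ →L[ℝ] ℝ →L[ℝ] ℂ :=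
    (ContinuousLinearMap.compL ℝ ℝ ℝ ℂ Complex.ofRealCLM).comp (ContinuousLinearMap.mul ℝ ℝ)
  refine ⟨SchwartzMap.pairing B (dil q hq) (dil q' hq'), fun x => ?_⟩
  rw [SchwartzMap.pairing_apply_apply]
  simp only [hdil, B, ContinuousLinearMap.comp_apply, ContinuousLinearMap.compL_apply,
    ContinuousLinearMap.mul_apply', Complex.ofRealCLM_apply, indicator_mul]

end RapidlyDecaying

lemma norm_fourier_neg_of_conj_eq {g : ℝ → ℂ} (hg : ∀ x, (starRingEnd ℂ) (g x) = g x) (w : ℝ) :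
    ‖𝓕 g (-w)‖ = ‖𝓕 g w‖ := by
  have h : 𝓕 g (-w) = (starRingEnd ℂ) (𝓕 g w) := by
    rw [Real.fourier_real_eq_integral_exp_smul, Real.fourier_real_eq_integral_exp_smul,
      ← integral_conj]
    refine integral_congr_ae (Eventually.of_forall fun x => ?_)
    simp [hg, ← Complex.exp_conj, Complex.conj_ofNat]
  rw [h, RCLike.norm_conj]

lemma SchwartzMap.integrable_norm_sq (f : 𝓢(ℝ, ℂ)) : Integrable fun x => ‖f x‖ ^ 2 := by
  have := (f.memLp 2 (μ := volume)).integrable_norm_pow (by norm_num)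
  simpa using this

lemma SchwartzMap.integrable_id_mul_norm_sq (f : 𝓢(ℝ, ℂ)) :
    Integrable fun x => x * ‖f x‖ ^ 2 := by
  have hf := f.continuous
  obtain ⟨C, hC⟩ := f.decay 0 0
  have h := (f.integrable_pow_mul volume 1).const_mul C
  refine h.mono (by fun_prop) (Eventually.of_forall fun x => ?_)
  have hx : ‖f x‖ ≤ C := by simpa using hC.2 x
  have hC0 : 0 < C := hC.1
  simp only [norm_mul, norm_pow, norm_norm, pow_one, Real.norm_of_nonneg hC0.le]
  nlinarith [mul_nonneg (norm_nonneg x) (norm_nonneg (f x))]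

lemma SchwartzMap.integral_mul_norm_fourier_sq {g : 𝓢(ℝ, ℂ)}
    (hg : ∀ x, (starRingEnd ℂ) (g x) = g x) (p : ℝ) :
    Integrable (fun p' : ℝ => p' * ‖𝓕 g ((p - p') / (2 * Real.pi))‖ ^ 2) ∧
    ∫ p' : ℝ, p' * ‖𝓕 g ((p - p') / (2 * Real.pi))‖ ^ 2 =
      2 * Real.pi * p * ∫ x, ‖g x‖ ^ 2 := by
  have hpi : (0 : ℝ) < 2 * Real.pi := by positivity
  set F : ℝ → ℝ := fun w => p * ‖𝓕 g w‖ ^ 2 - 2 * Real.pi * (w * ‖𝓕 g w‖ ^ 2) with hF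
  have h1 := (𝓕 g).integrable_norm_sq.const_mul p
  have h2 := (𝓕 g).integrable_id_mul_norm_sq.const_mul (2 * Real.pi)
  have hFi : Integrable F := h1.sub h2
  have heq : (fun p' : ℝ => p' * ‖𝓕 g ((p - p') / (2 * Real.pi))‖ ^ 2) =
      fun p' => F ((p - p') / (2 * Real.pi)) := by
    funext p'
    simp only [hF]
    field_simp
    ring
  have hodd : ∫ w, w * ‖𝓕 g w‖ ^ 2 = 0 := by
    have h := integral_neg_eq_self (fun w : ℝ => w * ‖𝓕 g w‖ ^ 2) volume
    have h' (w : ℝ) : ‖𝓕 g (-w)‖ = ‖𝓕 g w‖ := norm_fourier_neg_of_conj_eq hg w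
    simp only [h', neg_mul, integral_neg] at h
    linarith
  rw [heq]
  refine ⟨(hFi.comp_div hpi.ne').comp_sub_left p, ?_⟩
  rw [integral_sub_left_eq_self (fun y => F (y / (2 * Real.pi))) volume p,
    Measure.integral_comp_div, hF, integral_sub h1 h2, integral_const_mul, integral_const_mul,
    hodd, SchwartzMap.integral_norm_sq_fourier, abs_of_pos hpi, smul_eq_mul]
  ring

lemma hinner_Uop_eq_fourier {ψ : ℝ → ℝ} {q q' : ℝ} {g : 𝓢(ℝ, ℂ)}
    (hg : ∀ x, g x = ((Ioi (0 : ℝ)).indicator (fun x => ψ (x / q) * ψ (x / q')) x : ℝ))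
    (p p' : ℝ) :
    hinner (Uop q p (fun x => (ψ x : ℂ))) (Uop q' p' (fun x => (ψ x : ℂ))) =
      ((Real.sqrt q)⁻¹ * (Real.sqrt q')⁻¹ : ℝ) * 𝓕 g ((p - p') / (2 * Real.pi)) := by
  rw [SchwartzMap.fourier_coe, Real.fourier_real_eq_integral_exp_smul, ← integral_const_mul,
    hinner, ← integral_indicator measurableSet_Ioi]
  refine integral_congr_ae (Eventually.of_forall fun x => ?_)
  by_cases hx : x ∈ Ioi (0 : ℝ)
  · have hexp : Complex.exp (((-2 * Real.pi * x * ((p - p') / (2 * Real.pi)) : ℝ) : ℂ) *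
        Complex.I) = Complex.exp (-(Complex.I * p * x)) * Complex.exp (Complex.I * p' * x) := by
      rw [← Complex.exp_add]
      congr 1
      have : -2 * Real.pi * x * ((p - p') / (2 * Real.pi)) = (p' - p) * x := by
        field_simp
        ring
      rw [this]
      push_cast
      ring
    beta_reduce
    rw [hexp]
    simp only [hg, indicator_of_mem hx, Uop, map_mul, ← Complex.exp_conj, Complex.conj_I,
      Complex.conj_ofReal, map_inv₀, smul_eq_mul, neg_mul]
    push_cast
    ring
  · simp only [hg, indicator_of_notMem hx]
    simp

lemma integral_mul_norm_hinner_sq {ψ : ℝ → ℝ} (hψ : RapidlyDecaying ψ) {q q' : ℝ}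
    (hq : 0 < q) (hq' : 0 < q') (p : ℝ) :
    Integrable (fun p' : ℝ => q' * p' * ‖hinner (Uop q p (fun x => (ψ x : ℂ)))
          (Uop q' p' (fun x => (ψ x : ℂ)))‖ ^ 2) ∧
    ∫ p' : ℝ, q' * p' * ‖hinner (Uop q p (fun x => (ψ x : ℂ)))
          (Uop q' p' (fun x => (ψ x : ℂ)))‖ ^ 2 =
      2 * Real.pi * p / q * ∫ x in Ioi (0 : ℝ), ψ (x / q) ^ 2 * ψ (x / q') ^ 2 := by
  obtain ⟨g, hg⟩ := hψ.exists_schwartz_overlap hq hq'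
  have hreal (x : ℝ) : (starRingEnd ℂ) (g x) = g x := by rw [hg, Complex.conj_ofReal]
  obtain ⟨hi, hv⟩ := SchwartzMap.integral_mul_norm_fourier_sq hreal p
  have heq : (fun p' : ℝ => q' * p' * ‖hinner (Uop q p (fun x => (ψ x : ℂ)))
      (Uop q' p' (fun x => (ψ x : ℂ)))‖ ^ 2) =
      fun p' => q⁻¹ * (p' * ‖𝓕 g ((p - p') / (2 * Real.pi))‖ ^ 2) := by
    funext p'
    rw [hinner_Uop_eq_fourier hg, norm_mul, mul_pow, Complex.norm_real, Real.norm_eq_abs, sq_abs,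
      mul_pow, inv_pow, inv_pow, Real.sq_sqrt hq.le, Real.sq_sqrt hq'.le]
    field_simp
  rw [heq]
  refine ⟨hi.const_mul _, ?_⟩
  rw [integral_const_mul, hv, ← integral_indicator measurableSet_Ioi]
  have hsq : (fun x => ‖g x‖ ^ 2) =
      (Ioi (0 : ℝ)).indicator fun x => ψ (x / q) ^ 2 * ψ (x / q') ^ 2 := by
    funext x
    rw [hg, Complex.norm_real, Real.norm_eq_abs, sq_abs]
    by_cases hx : x ∈ Ioi (0 : ℝ)
    · simp only [indicator_of_mem hx, mul_pow]
    · simp [indicator_of_notMem hx]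
  rw [hsq]
  field_simp

lemma integral_comp_div_sq_Ioi {ψ : ℝ → ℝ}
    (hc0 : IntegrableOn (fun x => (ψ x) ^ 2 * x ^ (-(0 + 2) : ℝ)) (Ioi (0 : ℝ)))
    {x : ℝ} (hx : 0 < x) :
    IntegrableOn (fun a => ψ (x / a) ^ 2) (Ioi (0 : ℝ)) ∧
    ∫ a in Ioi (0 : ℝ), ψ (x / a) ^ 2 = x * cgamR 0 ψ := by
  set f : ℝ → ℝ := fun a => ψ a⁻¹ ^ 2 with hf
  have hcongr : EqOn (fun x => (ψ x) ^ 2 * x ^ (-(0 + 2) : ℝ))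
      (fun x => (|(-1 : ℝ)| * x ^ ((-1 : ℝ) - 1)) • f (x ^ (-1 : ℝ))) (Ioi 0) := by
    intro y hy
    have h2 : (-(0 + 2) : ℝ) = -1 - 1 := by norm_num
    simp only [hf, h2, abs_neg, abs_one, one_mul, smul_eq_mul, Real.rpow_neg_one, inv_inv]
    ring
  have hfi : IntegrableOn f (Ioi 0) := by
    rw [← integrableOn_Ioi_comp_rpow_iff f (p := -1) (by norm_num)]
    exact (integrableOn_congr_fun hcongr measurableSet_Ioi).mp hc0
  have hfv : ∫ a in Ioi (0 : ℝ), f a = cgamR 0 ψ := by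
    rw [← integral_comp_rpow_Ioi f (p := -1) (by norm_num)]
    exact (setIntegral_congr_fun measurableSet_Ioi hcongr).symm
  have heq : (fun a => ψ (x / a) ^ 2) = fun a => f (x⁻¹ * a) := by
    funext a
    simp [hf, div_eq_mul_inv, mul_comm]
  rw [heq]
  constructor
  · rw [integrableOn_Ioi_comp_mul_left_iff f 0 (inv_pos.mpr hx), mul_zero]
    exact hfi
  · rw [integral_comp_mul_left_Ioi f 0 (inv_pos.mpr hx), mul_zero, hfv, inv_inv, smul_eq_mul]

lemma integral_comp_div_sq_mul_id_Ioi {ψ : ℝ → ℝ}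
    (hcm3 : IntegrableOn (fun x => (ψ x) ^ 2 * x ^ (-(-3 + 2) : ℝ)) (Ioi (0 : ℝ)))
    {q : ℝ} (hq : 0 < q) :
    IntegrableOn (fun x => ψ (x / q) ^ 2 * x) (Ioi (0 : ℝ)) ∧
    ∫ x in Ioi (0 : ℝ), ψ (x / q) ^ 2 * x = q ^ 2 * cgamR (-3) ψ := by
  have hexp : (-(-3 + 2) : ℝ) = 1 := by norm_num
  simp only [hexp, Real.rpow_one] at hcm3
  have hc : cgamR (-3) ψ = ∫ x in Ioi (0 : ℝ), ψ x ^ 2 * x := by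
    simp only [cgamR, hexp, Real.rpow_one]
  have heq : (fun x => ψ (x / q) ^ 2 * x) =
      fun x => q * (fun y => ψ y ^ 2 * y) (q⁻¹ * x) := by
    funext x
    simp only [div_eq_inv_mul]
    field_simp
  rw [heq]
  constructor
  · refine Integrable.const_mul ?_ q
    refine (integrableOn_Ioi_comp_mul_left_iff (fun y => ψ y ^ 2 * y) 0 (inv_pos.mpr hq)).mpr ?_
    rwa [mul_zero]
  · rw [integral_const_mul, integral_comp_mul_left_Ioi (fun y => ψ y ^ 2 * y) 0 (inv_pos.mpr hq),
      mul_zero, inv_inv, smul_eq_mul, hc]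
    ring

lemma integrable_overlap {ψ : ℝ → ℝ} (hψ : Measurable ψ)
    (hc0 : IntegrableOn (fun x => (ψ x) ^ 2 * x ^ (-(0 + 2) : ℝ)) (Ioi (0 : ℝ)))
    (hcm3 : IntegrableOn (fun x => (ψ x) ^ 2 * x ^ (-(-3 + 2) : ℝ)) (Ioi (0 : ℝ)))
    {q : ℝ} (hq : 0 < q) :
    Integrable (Function.uncurry fun x q' => ψ (x / q) ^ 2 * ψ (x / q') ^ 2)
      ((volume.restrict (Ioi (0 : ℝ))).prod (volume.restrict (Ioi (0 : ℝ)))) := by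
  have hm : Measurable (Function.uncurry fun x q' => ψ (x / q) ^ 2 * ψ (x / q') ^ 2) := by
    unfold Function.uncurry
    fun_prop
  rw [integrable_prod_iff hm.aestronglyMeasurable]
  constructor
  · filter_upwards [self_mem_ae_restrict measurableSet_Ioi] with x hx
    exact (integral_comp_div_sq_Ioi hc0 hx).1.const_mul (ψ (x / q) ^ 2)
  · have h := (integral_comp_div_sq_mul_id_Ioi hcm3 hq).1.mul_const (cgamR 0 ψ)
    refine h.congr ?_
    filter_upwards [self_mem_ae_restrict measurableSet_Ioi] with x hx
    have hnn (y : ℝ) : ‖ψ (x / q) ^ 2 * ψ (x / y) ^ 2‖ = ψ (x / q) ^ 2 * ψ (x / y) ^ 2 :=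
      Real.norm_of_nonneg (by positivity)
    simp only [Function.uncurry_apply_pair, hnn]
    rw [integral_const_mul, (integral_comp_div_sq_Ioi hc0 hx).2, mul_assoc]

lemma integral_integral_overlap {ψ : ℝ → ℝ} (hψ : Measurable ψ)
    (hc0 : IntegrableOn (fun x => (ψ x) ^ 2 * x ^ (-(0 + 2) : ℝ)) (Ioi (0 : ℝ)))
    (hcm3 : IntegrableOn (fun x => (ψ x) ^ 2 * x ^ (-(-3 + 2) : ℝ)) (Ioi (0 : ℝ)))
    {q : ℝ} (hq : 0 < q) :
    ∫ q' in Ioi (0 : ℝ), ∫ x in Ioi (0 : ℝ), ψ (x / q) ^ 2 * ψ (x / q') ^ 2 =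
      q ^ 2 * cgamR (-3) ψ * cgamR 0 ψ := by
  rw [← integral_integral_swap (integrable_overlap hψ hc0 hcm3 hq),
    ← (integral_comp_div_sq_mul_id_Ioi hcm3 hq).2, ← integral_mul_const]
  refine setIntegral_congr_fun measurableSet_Ioi fun x hx => ?_
  simp only [integral_const_mul, (integral_comp_div_sq_Ioi hc0 hx).2, mul_assoc]

/-- The lower symbol of `qp` is `(c₀ c₋₃/c₋₁) qp`. -/
theorem lower_symbol_of_qp (ψ : ℝ → ℝ)
    (hψ : RapidlyDecaying ψ)
    (hnorm : ∫ x in Set.Ioi (0:ℝ), (ψ x) ^ 2 = 1)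
    (hc0 : IntegrableOn (fun x => (ψ x) ^ 2 * x ^ (-(0 + 2) : ℝ)) (Set.Ioi (0:ℝ)))
    (hcm3 : IntegrableOn (fun x => (ψ x) ^ 2 * x ^ (-(-3 + 2) : ℝ)) (Set.Ioi (0:ℝ)))
    (q p : ℝ) (hq : 0 < q) :
    (∀ q' ∈ Set.Ioi (0:ℝ), Integrable (fun p' : ℝ =>
        q' * p' * ‖hinner (Uop q p (fun x => (ψ x : ℂ)))
          (Uop q' p' (fun x => (ψ x : ℂ)))‖ ^ 2)) ∧
    IntegrableOn (fun q' : ℝ => ∫ p' : ℝ,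
        q' * p' * ‖hinner (Uop q p (fun x => (ψ x : ℂ)))
          (Uop q' p' (fun x => (ψ x : ℂ)))‖ ^ 2) (Set.Ioi (0:ℝ)) ∧
    (1 / (2 * Real.pi * cgamR (-1) ψ)) * (∫ q' in Set.Ioi (0:ℝ), ∫ p' : ℝ,
        q' * p' * ‖hinner (Uop q p (fun x => (ψ x : ℂ)))
          (Uop q' p' (fun x => (ψ x : ℂ)))‖ ^ 2) =
      (cgamR 0 ψ * cgamR (-3) ψ / cgamR (-1) ψ) * (q * p) := by
  have hmeas : Measurable ψ := hψ.1.continuous.measurable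
  have hcongr : EqOn (fun q' : ℝ => 2 * Real.pi * p / q *
      ∫ x in Ioi (0 : ℝ), ψ (x / q) ^ 2 * ψ (x / q') ^ 2)
      (fun q' : ℝ => ∫ p' : ℝ, q' * p' * ‖hinner (Uop q p (fun x => (ψ x : ℂ)))
        (Uop q' p' (fun x => (ψ x : ℂ)))‖ ^ 2) (Ioi 0) :=
    fun q' hq' => (integral_mul_norm_hinner_sq hψ hq hq' p).2.symm
  refine ⟨fun q' hq' => (integral_mul_norm_hinner_sq hψ hq hq' p).1, ?_, ?_⟩
  · refine (integrableOn_congr_fun hcongr measurableSet_Ioi).mp ?_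
    exact (integrable_overlap hmeas hc0 hcm3 hq).integral_prod_right.const_mul _
  · rw [← setIntegral_congr_fun measurableSet_Ioi hcongr, integral_const_mul,
      integral_integral_overlap hmeas hc0 hcm3 hq]
    rcases eq_or_ne (cgamR (-1) ψ) 0 with h | h
    · simp [h]
    · field_simp
end

section
/- Let ℏ > 0, λ > 0, K > −1/4, n ∈ ℕ, and set μ = (1/2)√(1+4K) and k̃ = 4 ℏ² λ². Define φ_n : (0,∞) → ℝ by φ_n(x) = x^{μ+1/2} e^{−λx²} L_n^{(μ)}(2λx²). Then φ_n satisfies, for all x > 0, the eigenvalue equation (1/2)( −ℏ² φ_n″(x) + ℏ² K x^{-2} φ_n(x) + k̃ x² φ_n(x) ) = E_n φ_n(x) with E_n = 2ℏ²λ(2n + μ + 1). (Bound states of the ACS-quantized 'breathing massive sphere' Hamiltonian, a half-harmonic oscillator with centrifugal correction.) -/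
open Set

/-- The generalized Laguerre polynomial
`L_n^{(α)}(t) = Σ_{k=0}^{n} (−1)^k Γ(n+α+1) / (Γ(k+α+1) (n−k)! k!) t^k`. -/
noncomputable def laguerre (n : ℕ) (α : ℝ) (t : ℝ) : ℝ :=
  ∑ k ∈ Finset.range (n + 1),
    (-1 : ℝ) ^ k *
      (Real.Gamma ((n : ℝ) + α + 1) /
        (Real.Gamma ((k : ℝ) + α + 1) * (Nat.factorial (n - k) : ℝ) *
          (Nat.factorial k : ℝ))) * t ^ k

open Polynomial in
/-- The generalized Laguerre polynomial as an element of `ℝ[X]`. -/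
noncomputable def laguerrePolynomial (n : ℕ) (α : ℝ) : ℝ[X] :=
  ∑ k ∈ Finset.range (n + 1),
    C ((-1 : ℝ) ^ k *
      (Real.Gamma ((n : ℝ) + α + 1) /
        (Real.Gamma ((k : ℝ) + α + 1) * (Nat.factorial (n - k) : ℝ) *
          (Nat.factorial k : ℝ)))) * X ^ k

theorem eval_laguerrePolynomial (n : ℕ) (α t : ℝ) :
    (laguerrePolynomial n α).eval t = laguerre n α t := by
  simp [laguerrePolynomial, laguerre, Polynomial.eval_finsetSum]

theorem coeff_laguerrePolynomial (n : ℕ) (α : ℝ) (k : ℕ) :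
    (laguerrePolynomial n α).coeff k =
      if k ≤ n then (-1 : ℝ) ^ k *
        (Real.Gamma ((n : ℝ) + α + 1) /
          (Real.Gamma ((k : ℝ) + α + 1) * (Nat.factorial (n - k) : ℝ) *
            (Nat.factorial k : ℝ))) else 0 := by
  simp only [laguerrePolynomial, Polynomial.finsetSum_coeff, Polynomial.coeff_C_mul_X_pow,
    Finset.sum_ite_eq, Finset.mem_range, Nat.lt_succ_iff]

theorem coeff_succ_laguerrePolynomial (n : ℕ) {α : ℝ} (hα : -1 < α) (k : ℕ) :
    ((k : ℝ) + 1) * (k + α + 1) * (laguerrePolynomial n α).coeff (k + 1) =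
      (k - n) * (laguerrePolynomial n α).coeff k := by
  rw [coeff_laguerrePolynomial, coeff_laguerrePolynomial]
  rcases lt_trichotomy k n with h | rfl | h
  · obtain ⟨m, rfl⟩ := Nat.exists_eq_add_of_lt h
    have hpos : 0 < (k : ℝ) + α + 1 := by
      have := Nat.cast_nonneg (α := ℝ) k
      linarith
    have hΓ := (Real.Gamma_pos_of_pos hpos).ne'
    have e : ((k + 1 : ℕ) : ℝ) + α + 1 = (k + α + 1) + 1 := by push_cast; ring
    rw [if_pos (by omega), if_pos (by omega), e, Real.Gamma_add_one hpos.ne',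
      show k + m + 1 - (k + 1) = m by omega, show k + m + 1 - k = m + 1 by omega,
      Nat.factorial_succ, Nat.factorial_succ]
    have hm := Nat.cast_ne_zero (R := ℝ).mpr m.factorial_ne_zero
    have hk := Nat.cast_ne_zero (R := ℝ).mpr k.factorial_ne_zero
    have hm' : (m : ℝ) + 1 ≠ 0 := by positivity
    have hk' : (k : ℝ) + 1 ≠ 0 := by positivity
    have hpos' := hpos.ne'
    push_cast
    field_simp
    ring
  · simp
  · rw [if_neg (by omega), if_neg (by omega)]
    simp

open Polynomial in
/-- Laguerre's differential equation `t L'' + (α + 1 - t) L' + n L = 0`. -/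
theorem laguerrePolynomial_ode (n : ℕ) {α : ℝ} (hα : -1 < α) :
    X * derivative (derivative (laguerrePolynomial n α)) +
      (C (α + 1) - X) * derivative (laguerrePolynomial n α) +
        C (n : ℝ) * laguerrePolynomial n α = 0 := by
  ext k
  have h := coeff_succ_laguerrePolynomial n hα k
  rw [sub_mul]
  cases k with
  | zero =>
    simp [-map_add, coeff_derivative] at h ⊢
    linarith
  | succ k =>
    simp [-map_add, coeff_derivative, coeff_X_mul, coeff_C_mul] at h ⊢
    linarith

open Polynomial in
theorem hasDerivAt_rpow_mul_exp_mul_eval (lam b : ℝ) (q : ℝ[X]) {x : ℝ} (hx : 0 < x) :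
    HasDerivAt (fun y : ℝ => y ^ b * Real.exp (-lam * y ^ 2) * q.eval (2 * lam * y ^ 2))
      (x ^ (b - 1) * Real.exp (-lam * x ^ 2) *
        ((C b - X) * q + 2 * X * derivative q).eval (2 * lam * x ^ 2)) x := by
  have h₁ := Real.hasDerivAt_rpow_const (p := b) (Or.inl hx.ne')
  have h₂ := ((hasDerivAt_pow 2 x).const_mul (-lam)).exp
  have h₃ := (q.hasDerivAt (2 * lam * x ^ 2)).comp x ((hasDerivAt_pow 2 x).const_mul (2 * lam))
  have e : x ^ b = x ^ (b - 1) * x := by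
    rw [← Real.rpow_add_one hx.ne', sub_add_cancel]
  refine ((h₁.mul h₂).mul h₃).congr_deriv ?_
  simp [e]
  ring

open Polynomial in
theorem deriv_deriv_rpow_mul_exp_mul_eval (lam b : ℝ) (q : ℝ[X]) {x : ℝ} (hx : 0 < x) :
    deriv (deriv fun y : ℝ => y ^ b * Real.exp (-lam * y ^ 2) * q.eval (2 * lam * y ^ 2)) x =
      x ^ (b - 1 - 1) * Real.exp (-lam * x ^ 2) *
        ((C (b - 1) - X) * ((C b - X) * q + 2 * X * derivative q) +
          2 * X * derivative ((C b - X) * q + 2 * X * derivative q)).eval (2 * lam * x ^ 2) := by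
  rw [← (hasDerivAt_rpow_mul_exp_mul_eval lam (b - 1) _ hx).deriv]
  refine Filter.EventuallyEq.deriv_eq ?_
  filter_upwards [Ioi_mem_nhds hx] with y hy
  exact (hasDerivAt_rpow_mul_exp_mul_eval lam b q hy).deriv

/-- Bound states of the ACS-quantized breathing-sphere Hamiltonian
(half-harmonic oscillator with centrifugal term): with `μ = (1/2)√(1+4K)` and
`k̃ = 4ℏ²λ²`, the function `φ_n(x) = x^{μ+1/2} e^{−λx²} L_n^{(μ)}(2λx²)` satisfies
`(1/2)(−ℏ²φ_n″ + ℏ²K x⁻² φ_n + k̃ x² φ_n) = E_n φ_n` with `E_n = 2ℏ²λ(2n+μ+1)`. -/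
theorem breathing_sphere_bound_states (ℏ lam K : ℝ) (n : ℕ)
    (hℏ : 0 < ℏ) (hlam : 0 < lam) (hK : -(1/4 : ℝ) < K) :
    ∀ x ∈ Set.Ioi (0:ℝ),
      (1/2 : ℝ) *
          (-ℏ ^ 2 * deriv (deriv (fun y : ℝ =>
              y ^ (Real.sqrt (1 + 4 * K) / 2 + 1/2) * Real.exp (-lam * y ^ 2) *
                laguerre n (Real.sqrt (1 + 4 * K) / 2) (2 * lam * y ^ 2))) x +
            ℏ ^ 2 * K * x⁻¹ ^ 2 *
              (x ^ (Real.sqrt (1 + 4 * K) / 2 + 1/2) * Real.exp (-lam * x ^ 2) *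
                laguerre n (Real.sqrt (1 + 4 * K) / 2) (2 * lam * x ^ 2)) +
            (4 * ℏ ^ 2 * lam ^ 2) * x ^ 2 *
              (x ^ (Real.sqrt (1 + 4 * K) / 2 + 1/2) * Real.exp (-lam * x ^ 2) *
                laguerre n (Real.sqrt (1 + 4 * K) / 2) (2 * lam * x ^ 2))) =
        (2 * ℏ ^ 2 * lam * (2 * (n : ℝ) + Real.sqrt (1 + 4 * K) / 2 + 1)) *
          (x ^ (Real.sqrt (1 + 4 * K) / 2 + 1/2) * Real.exp (-lam * x ^ 2) *
            laguerre n (Real.sqrt (1 + 4 * K) / 2) (2 * lam * x ^ 2)) := by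
  intro x hx
  have hx : 0 < x := hx
  simp only [← eval_laguerrePolynomial]
  rw [deriv_deriv_rpow_mul_exp_mul_eval lam _ _ hx]
  have hμ : (Real.sqrt (1 + 4 * K) / 2) ^ 2 = K + 1 / 4 := by
    rw [div_pow, Real.sq_sqrt (by linarith)]
    ring
  have hμ0 : -1 < Real.sqrt (1 + 4 * K) / 2 := by
    have := Real.sqrt_nonneg (1 + 4 * K)
    linarith
  generalize Real.sqrt (1 + 4 * K) / 2 = μ at hμ hμ0 ⊢
  have ode := congrArg (Polynomial.eval (2 * lam * x ^ 2)) (laguerrePolynomial_ode n hμ0)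
  have e : x ^ (μ + 1 / 2) = x ^ (μ + 1 / 2 - 1 - 1) * x ^ 2 := by
    rw [← Real.rpow_add_natCast hx.ne']
    congr 1
    push_cast
    ring
  obtain rfl : K = μ ^ 2 - 1 / 4 := by linarith
  rw [e]
  simp at ode ⊢
  generalize x ^ (μ + 1 / 2 - 1 - 1) = r
  generalize Real.exp (-(lam * x ^ 2)) = g
  field_simp
  linear_combination (-128 * g * lam * x ^ 2) * ode
end

section
/- Let ℏ > 0, α > 0, κ > 0, n ∈ ℕ, and set K = α(α−1) and b = ℏ² κ (n+α). Define φ_n : (0,∞) → ℝ by φ_n(x) = e^{−κx} (κx)^{α} L_n^{(2α−1)}(2κx). Then φ_n satisfies, for all x > 0, the eigenvalue equation (1/2)( −ℏ² φ_n″(x) + ℏ² K x^{-2} φ_n(x) − (2b/x) φ_n(x) ) = E_n φ_n(x) with E_n = −ℏ²κ²/2 = −b²/(2ℏ²(n+α)²). (Bound states of the ACS-quantized Kepler-like Hamiltonian of the Newtonian dust-sphere cosmological model; with b = GM/c₋₁ this gives E_n = −G²M²/(2ℏ²c₋₁²(n+α)²).) -/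
open Set

open Polynomial in
/-- The generalized Laguerre polynomial as an element of `ℝ[X]`. -/
noncomputable def laguerrePoly (n : ℕ) (a : ℝ) : ℝ[X] :=
  ∑ k ∈ Finset.range (n + 1),
    monomial k ((-1 : ℝ) ^ k *
      (Real.Gamma ((n : ℝ) + a + 1) /
        (Real.Gamma ((k : ℝ) + a + 1) * (Nat.factorial (n - k) : ℝ) *
          (Nat.factorial k : ℝ))))

theorem laguerrePoly_eval (n : ℕ) (a t : ℝ) : (laguerrePoly n a).eval t = laguerre n a t := by
  simp [laguerrePoly, laguerre, Polynomial.eval_finsetSum]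

theorem laguerrePoly_coeff (n : ℕ) (a : ℝ) (k : ℕ) :
    (laguerrePoly n a).coeff k = if k < n + 1 then (-1 : ℝ) ^ k *
      (Real.Gamma ((n : ℝ) + a + 1) /
        (Real.Gamma ((k : ℝ) + a + 1) * (Nat.factorial (n - k) : ℝ) *
          (Nat.factorial k : ℝ))) else 0 := by
  simp [laguerrePoly, Polynomial.coeff_monomial]

theorem laguerrePoly_coeff_succ (n : ℕ) {a : ℝ} (ha : -1 < a) (k : ℕ) :
    ((k : ℝ) + 1) * (k + 1 + a) * (laguerrePoly n a).coeff (k + 1) =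
      (k - n) * (laguerrePoly n a).coeff k := by
  rw [laguerrePoly_coeff, laguerrePoly_coeff]
  rcases lt_trichotomy k n with h | rfl | h
  · obtain ⟨m, rfl⟩ := Nat.exists_eq_add_of_lt h
    have hpos : 0 < (k : ℝ) + a + 1 := by
      have : (0 : ℝ) ≤ k := k.cast_nonneg
      linarith
    have hΓ : Real.Gamma (((k + 1 : ℕ) : ℝ) + a + 1) =
        ((k : ℝ) + a + 1) * Real.Gamma ((k : ℝ) + a + 1) := by
      rw [← Real.Gamma_add_one hpos.ne']
      congr 1
      push_cast
      ring
    have hΓ0 := (Real.Gamma_pos_of_pos hpos).ne'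
    rw [if_pos (by omega), if_pos (by omega), hΓ,
      show k + m + 1 - (k + 1) = m by omega, show k + m + 1 - k = m + 1 by omega,
      Nat.factorial_succ, Nat.factorial_succ]
    have hm := Nat.factorial_ne_zero m
    have hk := Nat.factorial_ne_zero k
    have hpos' := hpos.ne'
    have hm1 : (m : ℝ) + 1 ≠ 0 := by positivity
    have hk1 : (k : ℝ) + 1 ≠ 0 := by positivity
    push_cast
    field_simp
    ring
  · simp
  · rw [if_neg (by omega), if_neg (by omega)]
    simp

open Polynomial in
theorem laguerrePoly_ode (n : ℕ) {a : ℝ} (ha : -1 < a) :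
    X * derivative (derivative (laguerrePoly n a)) +
      (C (a + 1) - X) * derivative (laguerrePoly n a) + C (n : ℝ) * laguerrePoly n a = 0 := by
  ext k
  have h := laguerrePoly_coeff_succ n ha k
  cases k with
  | zero =>
    simp [sub_mul, coeff_derivative] at h ⊢
    linarith
  | succ k =>
    simp only [coeff_add, sub_mul, coeff_sub, coeff_C_mul, coeff_X_mul, coeff_derivative,
      coeff_zero]
    push_cast at h ⊢
    linarith

/-- A bound-state profile `e^{-κy} (κy)^β P(2κy)` differentiates into a profile of exponent
`β - 1`. -/
theorem hasDerivAt_exp_mul_rpow_mul_eval {κ : ℝ} (hκ : 0 < κ) (β : ℝ) (P : Polynomial ℝ) {x : ℝ}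
    (hx : 0 < x) :
    HasDerivAt (fun y : ℝ => Real.exp (-κ * y) * (κ * y) ^ β * P.eval (2 * κ * y))
      (Real.exp (-κ * x) * (κ * x) ^ (β - 1) *
        (κ * ((β - κ * x) * P.eval (2 * κ * x) +
          2 * κ * x * P.derivative.eval (2 * κ * x)))) x := by
  have hκx : 0 < κ * x := mul_pos hκ hx
  have h1 : HasDerivAt (fun y : ℝ => Real.exp (-κ * y)) (Real.exp (-κ * x) * (-κ)) x := by
    simpa using ((hasDerivAt_id x).const_mul (-κ)).exp
  have h2 : HasDerivAt (fun y : ℝ => (κ * y) ^ β) (κ * β * (κ * x) ^ (β - 1)) x := by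
    simpa using
      ((hasDerivAt_id x).const_mul κ).rpow_const (p := β) (Or.inl (by simpa using hκx.ne'))
  have h3 : HasDerivAt (fun y : ℝ => P.eval (2 * κ * y))
      (P.derivative.eval (2 * κ * x) * (2 * κ)) x := by
    have hlin : HasDerivAt (fun y : ℝ => 2 * κ * y) (2 * κ) x := by
      simpa using (hasDerivAt_id x).const_mul (2 * κ)
    exact (P.hasDerivAt (2 * κ * x)).comp x hlin
  refine ((h1.mul h2).mul h3).congr_deriv ?_
  have hpow : (κ * x) ^ β = (κ * x) ^ (β - 1) * (κ * x) := by
    rw [← Real.rpow_add_one hκx.ne', sub_add_cancel]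
  simp only [Pi.mul_apply, hpow]
  ring

open Polynomial in
theorem deriv_deriv_exp_mul_rpow_mul_eval {κ : ℝ} (hκ : 0 < κ) (β : ℝ) (P : ℝ[X]) {x : ℝ}
    (hx : 0 < x) :
    deriv (deriv fun y : ℝ => Real.exp (-κ * y) * (κ * y) ^ β * P.eval (2 * κ * y)) x =
      Real.exp (-κ * x) * (κ * x) ^ (β - 2) * κ ^ 2 *
        (((κ * x) ^ 2 - 2 * β * (κ * x) + β * (β - 1)) * P.eval (2 * κ * x) +
          4 * (κ * x) * (β - κ * x) * P.derivative.eval (2 * κ * x) +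
          4 * (κ * x) ^ 2 * P.derivative.derivative.eval (2 * κ * x)) := by
  let Q : ℝ[X] := C κ * ((C β - C (1 / 2) * X) * P + X * derivative P)
  have hQ (y : ℝ) : Q.eval (2 * κ * y) = κ * ((β - κ * y) * P.eval (2 * κ * y) +
      2 * κ * y * P.derivative.eval (2 * κ * y)) := by
    simp only [Q, eval_mul, eval_add, eval_sub, eval_C, eval_X]
    ring
  have heq : (deriv fun y : ℝ => Real.exp (-κ * y) * (κ * y) ^ β * P.eval (2 * κ * y)) =ᶠ[nhds x]
      fun y => Real.exp (-κ * y) * (κ * y) ^ (β - 1) * Q.eval (2 * κ * y) := by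
    filter_upwards [lt_mem_nhds hx] with y hy
    rw [hQ, (hasDerivAt_exp_mul_rpow_mul_eval hκ β P hy).deriv]
  rw [heq.deriv_eq, (hasDerivAt_exp_mul_rpow_mul_eval hκ (β - 1) Q hx).deriv, hQ,
    show β - 1 - 1 = β - 2 by ring]
  simp only [Q, derivative_mul, derivative_add, derivative_sub, derivative_C, derivative_X,
    eval_mul, eval_add, eval_sub, eval_C, eval_X, eval_zero, eval_one]
  ring

/-- Bound states of the ACS-quantized Kepler-like Hamiltonian of the
Newtonian dust-sphere cosmology: with `K = α(α−1)` and `b = ℏ²κ(n+α)`, the function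
`φ_n(x) = e^{−κx} (κx)^α L_n^{(2α−1)}(2κx)` satisfies
`(1/2)(−ℏ²φ_n″ + ℏ²K x⁻² φ_n − (2b/x) φ_n) = E_n φ_n` with
`E_n = −ℏ²κ²/2 = −b²/(2ℏ²(n+α)²)`. -/
theorem dust_sphere_bound_states (ℏ κ α : ℝ) (n : ℕ)
    (hℏ : 0 < ℏ) (hκ : 0 < κ) (hα : 0 < α) :
    (∀ x ∈ Set.Ioi (0:ℝ),
      (1/2 : ℝ) *
          (-ℏ ^ 2 * deriv (deriv (fun y : ℝ =>
              Real.exp (-κ * y) * (κ * y) ^ α * laguerre n (2 * α - 1) (2 * κ * y))) x +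
            ℏ ^ 2 * (α * (α - 1)) * x⁻¹ ^ 2 *
              (Real.exp (-κ * x) * (κ * x) ^ α * laguerre n (2 * α - 1) (2 * κ * x)) -
            (2 * (ℏ ^ 2 * κ * ((n : ℝ) + α)) / x) *
              (Real.exp (-κ * x) * (κ * x) ^ α * laguerre n (2 * α - 1) (2 * κ * x))) =
        (-(ℏ ^ 2 * κ ^ 2 / 2)) *
          (Real.exp (-κ * x) * (κ * x) ^ α * laguerre n (2 * α - 1) (2 * κ * x))) ∧
    -(ℏ ^ 2 * κ ^ 2 / 2) =
      -(ℏ ^ 2 * κ * ((n : ℝ) + α)) ^ 2 / (2 * ℏ ^ 2 * ((n : ℝ) + α) ^ 2) := by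
  constructor
  · intro x hx
    have hx : 0 < x := hx
    have hκx : 0 < κ * x := mul_pos hκ hx
    have hode := congrArg (Polynomial.eval (2 * κ * x))
      (laguerrePoly_ode n (a := 2 * α - 1) (by linarith))
    simp only [Polynomial.eval_add, Polynomial.eval_mul, Polynomial.eval_sub, Polynomial.eval_X,
      Polynomial.eval_C, Polynomial.eval_zero] at hode
    have hpow : (κ * x) ^ α = (κ * x) ^ (α - 2) * (κ * x) ^ 2 := by
      rw [← Real.rpow_natCast, ← Real.rpow_add hκx]
      congr 1
      push_cast
      ring
    simp only [← laguerrePoly_eval]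
    rw [deriv_deriv_exp_mul_rpow_mul_eval hκ α _ hx, hpow]
    field_simp
    linear_combination (-2 * κ * x) * hode
  · have : (n : ℝ) + α ≠ 0 := by positivity
    field_simp
end
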